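/- Let d ≥ 1, and let u ∈ C¹([0,1], ℓ²(ℤ^d)) satisfy the differential inequality |i∂_t u_j(t) + Δ_d u_j(t)| ≤ |V_j(t) u_j(t)| for all t ∈ [0,1] and j ∈ ℤ^d. Assume that ∫₀¹ Σ_{j∈ℤ^d} |u_j(t)|² dt ≤ A², that ∫_{1/2−1/8}^{1/2+1/8} |u_0(t)|² dt ≥ 1 (where u_0 denotes the value of u at the lattice point j = 0), and that ‖V‖_∞ := sup_{t∈[0,1], j∈ℤ^d} |V_j(t)| ≤ L. Then there exist R₀ = R₀(d, A, L) > 0 and c = c(d) > 0 such that for every R ≥ R₀, λ(R) := (∫₀¹ Σ_{j∈ℤ^d, R−2 ≤ |j| ≤ R+1} |u_j(t)|² dt)^{1/2} ≥ c e^{−c R log R}. -/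

import Mathlib

open MeasureTheory
open scoped ENNReal NNReal

/-- Euclidean norm of a lattice point of `ℤ^d`. -/
noncomputable def latNorm {d : ℕ} (j : Fin d → ℤ) : ℝ :=
  Real.sqrt (∑ k, ((j k : ℝ)) ^ 2)

/-- Discrete Laplacian on `ℤ^d`:
`Δ_d f j = Σ_{k=1}^d (f (j+e_k) + f (j-e_k) - 2 f j)`. -/
noncomputable def discreteLap {d : ℕ} (f : (Fin d → ℤ) → ℂ) (j : Fin d → ℤ) : ℂ :=
  ∑ k, (f (j + Pi.single k 1) + f (j - Pi.single k 1) - 2 * f j)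

/-- The sum of `x` over the nearest neighbours of `j` in `ℤ^d`. -/
def nbrSum {d : ℕ} (x : (Fin d → ℤ) → ℝ) (j : Fin d → ℤ) : ℝ :=
  ∑ k, (x (j + Pi.single k 1) + x (j - Pi.single k 1))

lemma latNorm_eq_norm {d : ℕ} (j : Fin d → ℤ) :
    latNorm j = ‖WithLp.toLp 2 (fun k => (j k : ℝ))‖ := by
  rw [EuclideanSpace.norm_eq]
  simp [latNorm]

lemma latNorm_zero {d : ℕ} : latNorm (0 : Fin d → ℤ) = 0 := by simp [latNorm]

lemma abs_coord_le_latNorm {d : ℕ} (j : Fin d → ℤ) (k : Fin d) : |(j k : ℝ)| ≤ latNorm j := by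
  rw [latNorm_eq_norm]
  exact PiLp.norm_apply_le (WithLp.toLp 2 (fun k => (j k : ℝ))) k

lemma latNorm_add_le {d : ℕ} (i j : Fin d → ℤ) : latNorm (i + j) ≤ latNorm i + latNorm j := by
  simp only [latNorm_eq_norm]
  refine le_trans (le_of_eq ?_) (norm_add_le _ _)
  congr 1
  ext k
  simp

lemma latNorm_neg {d : ℕ} (j : Fin d → ℤ) : latNorm (-j) = latNorm j := by simp [latNorm]

lemma latNorm_single {d : ℕ} (k : Fin d) : latNorm (Pi.single k 1 : Fin d → ℤ) = 1 := by
  have h : (WithLp.toLp 2 (fun l => ((Pi.single k 1 : Fin d → ℤ) l : ℝ)))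
      = EuclideanSpace.single k (1 : ℝ) := by
    ext l
    by_cases h : l = k
    · subst h; simp
    · simp [h]
  rw [latNorm_eq_norm, h]
  simp

lemma latNorm_add_single_le {d : ℕ} (j : Fin d → ℤ) (k : Fin d) :
    latNorm (j + Pi.single k 1) ≤ latNorm j + 1 := by
  simpa [latNorm_single] using latNorm_add_le j (Pi.single k 1)

lemma latNorm_sub_single_le {d : ℕ} (j : Fin d → ℤ) (k : Fin d) :
    latNorm (j - Pi.single k 1) ≤ latNorm j + 1 := by
  simpa [latNorm_single, latNorm_neg, sub_eq_add_neg] using latNorm_add_le j (-Pi.single k 1)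

lemma finite_latNorm_le {d : ℕ} (R : ℝ) : {j : Fin d → ℤ | latNorm j ≤ R}.Finite := by
  refine (Set.finite_Icc (fun _ => -⌈R⌉ : Fin d → ℤ) (fun _ => ⌈R⌉)).subset ?_
  intro j hj
  have h : ∀ k, |j k| ≤ ⌈R⌉ := fun k => by
    have h1 := (abs_coord_le_latNorm j k).trans (le_trans hj (Int.le_ceil R))
    exact_mod_cast h1
  exact ⟨fun k => (abs_le.1 (h k)).1, fun k => (abs_le.1 (h k)).2⟩

lemma summable_of_eq_zero_of_finite {ι : Type*} {B : Set ι} (hB : B.Finite) {F : ι → ℝ}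
    (h : ∀ j, j ∉ B → F j = 0) : Summable F :=
  summable_of_hasFiniteSupport (hB.subset fun j hj => by
    by_contra hjB
    exact hj (h j hjB))

lemma tsum_add_shift {G : Type*} [AddGroup G] (F : G → ℝ) (v : G) :
    ∑' j, F (j + v) = ∑' j, F j :=
  (Equiv.addRight v).tsum_eq F

lemma tsum_sub_shift {G : Type*} [AddGroup G] (F : G → ℝ) (v : G) :
    ∑' j, F (j - v) = ∑' j, F j :=
  (Equiv.subRight v).tsum_eq F

lemma summable_add_shift {G : Type*} [AddGroup G] {F : G → ℝ} (hF : Summable F) (v : G) :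
    Summable fun j => F (j + v) :=
  (Equiv.addRight v).summable_iff.2 hF

lemma summable_sub_shift {G : Type*} [AddGroup G] {F : G → ℝ} (hF : Summable F) (v : G) :
    Summable fun j => F (j - v) :=
  (Equiv.subRight v).summable_iff.2 hF

/-- Commutator inequality for a weighted shift `(T p)_j = K_j p_{j-e}`: up to a total time
derivative (with `r` in the role of `∂_t p`), `‖(i∂_t + T) p‖²` controls `⟨[T*, T] p, p⟩`. -/
lemma weighted_shift_commutator {G : Type*} [AddCommGroup G] {B : Set G} (hB : B.Finite)
    (e : G) (K : G → ℝ) (p r : G → ℂ) (hp : ∀ j, j ∉ B → p j = 0) (hr : ∀ j, j ∉ B → r j = 0) :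
    ∑' j, (K (j + e) ^ 2 - K j ^ 2) * ‖p j‖ ^ 2
      - 2 * ∑' j, (r j * star (K j * p (j - e)) + p j * star (K j * r (j - e))).im
      ≤ ∑' j, ‖Complex.I * r j + K j * p (j - e)‖ ^ 2 := by
  have key : ∀ a b : ℂ, ‖Complex.I * a + b‖ ^ 2 = ‖a‖ ^ 2 + ‖b‖ ^ 2 - 2 * (a * star b).im := by
    intro a b
    simp only [Complex.sq_norm, Complex.normSq_apply]
    simp
    ring
  set F1 : G → ℝ := fun j => ‖r j‖ ^ 2 with hF1
  set F2 : G → ℝ := fun j => K (j + e) ^ 2 * ‖p j‖ ^ 2 with hF2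
  set F3 : G → ℝ := fun j => K j ^ 2 * ‖p j‖ ^ 2 with hF3
  set F4 : G → ℝ := fun j => (r j * star (K j * p (j - e))).im with hF4
  set F5 : G → ℝ := fun j => (p j * star (K j * r (j - e))).im with hF5
  have s1 : Summable F1 := summable_of_eq_zero_of_finite hB fun j hj => by simp [hF1, hr j hj]
  have s2 : Summable F2 := summable_of_eq_zero_of_finite hB fun j hj => by simp [hF2, hp j hj]
  have s3 : Summable F3 := summable_of_eq_zero_of_finite hB fun j hj => by simp [hF3, hp j hj]
  have s4 : Summable F4 := summable_of_eq_zero_of_finite hB fun j hj => by simp [hF4, hr j hj]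
  have s5 : Summable F5 := summable_of_eq_zero_of_finite hB fun j hj => by simp [hF5, hp j hj]
  have e1 : ∀ j, ‖Complex.I * r j + K j * p (j - e)‖ ^ 2 = F1 j + F2 (j - e) - 2 * F4 j := by
    intro j
    rw [key]
    simp [hF1, hF2, hF4, mul_pow]
  have e2 : ∀ j, ‖Complex.I * r j + K (j + e) * p (j + e)‖ ^ 2
      = F1 j + F3 (j + e) + 2 * F5 (j + e) := by
    intro j
    rw [key]
    simp [hF1, hF3, hF5, mul_pow]
    ring
  have t1 : ∑' j, ‖Complex.I * r j + K j * p (j - e)‖ ^ 2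
      = ∑' j, F1 j + ∑' j, F2 j - 2 * ∑' j, F4 j := by
    simp_rw [e1]
    rw [Summable.tsum_sub (s1.add (summable_sub_shift s2 e)) (s4.mul_left 2),
      Summable.tsum_add s1 (summable_sub_shift s2 e), tsum_sub_shift, tsum_mul_left]
  have t2 : ∑' j, ‖Complex.I * r j + K (j + e) * p (j + e)‖ ^ 2
      = ∑' j, F1 j + ∑' j, F3 j + 2 * ∑' j, F5 j := by
    simp_rw [e2]
    rw [Summable.tsum_add (s1.add (summable_add_shift s3 e))
      ((summable_add_shift s5 e).mul_left 2),
      Summable.tsum_add s1 (summable_add_shift s3 e), tsum_add_shift, tsum_mul_left,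
      tsum_add_shift]
  have t3 : ∑' j, (K (j + e) ^ 2 - K j ^ 2) * ‖p j‖ ^ 2 = ∑' j, F2 j - ∑' j, F3 j := by
    rw [← Summable.tsum_sub s2 s3]
    exact tsum_congr fun j => by simp only [hF2, hF3]; ring
  have t4 : ∑' j, (r j * star (K j * p (j - e)) + p j * star (K j * r (j - e))).im
      = ∑' j, F4 j + ∑' j, F5 j := by
    rw [← Summable.tsum_add s4 s5]
    exact tsum_congr fun j => by simp only [hF4, hF5, Complex.add_im]
  have h2 : 0 ≤ ∑' j, ‖Complex.I * r j + K (j + e) * p (j + e)‖ ^ 2 :=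
    tsum_nonneg fun j => by positivity
  rw [t1, t3, t4]
  linarith

lemma nbrSum_sq_le {d : ℕ} (x : (Fin d → ℤ) → ℝ) (j : Fin d → ℤ) :
    nbrSum x j ^ 2 ≤ 2 * d * nbrSum (fun n => x n ^ 2) j := by
  unfold nbrSum
  refine sq_sum_le_card_mul_sum_sq.trans ?_
  rw [Finset.card_univ, Fintype.card_fin, mul_assoc, mul_left_comm]
  refine mul_le_mul_of_nonneg_left ?_ (Nat.cast_nonneg d)
  rw [Finset.mul_sum]
  refine Finset.sum_le_sum fun k _ => ?_
  nlinarith [sq_nonneg (x (j + Pi.single k 1) - x (j - Pi.single k 1))]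

lemma summable_nbrSum {d : ℕ} {x : (Fin d → ℤ) → ℝ} (hx : Summable x) :
    Summable (nbrSum x) :=
  summable_sum fun k _ =>
    (summable_add_shift hx (Pi.single k 1)).add (summable_sub_shift hx (Pi.single k 1))

lemma tsum_nbrSum {d : ℕ} {x : (Fin d → ℤ) → ℝ} (hx : Summable x) :
    ∑' j, nbrSum x j = 2 * d * ∑' j, x j := by
  unfold nbrSum
  rw [Summable.tsum_finsetSum fun k _ =>
    (summable_add_shift hx (Pi.single k 1)).add (summable_sub_shift hx (Pi.single k 1))]
  simp_rw [Summable.tsum_add (summable_add_shift hx (Pi.single _ 1))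
    (summable_sub_shift hx (Pi.single _ 1)), tsum_add_shift, tsum_sub_shift]
  simp
  ring

lemma nbrSum_nonneg {d : ℕ} {x : (Fin d → ℤ) → ℝ} (hx : ∀ j, 0 ≤ x j) (j : Fin d → ℤ) :
    0 ≤ nbrSum x j :=
  Finset.sum_nonneg fun _ _ => add_nonneg (hx _) (hx _)

/-- Removing the backward neighbour in the direction `i₀` from the Laplacian leaves a term which is
bounded in weighted norms, for weights increasing in that direction. -/
lemma weight_mul_norm_discreteLap_sub_le {d : ℕ} (i₀ : Fin d) (ω : ℤ → ℝ) (hω : ∀ n, 0 < ω n)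
    (g : (Fin d → ℤ) → ℂ) (hmono : ∀ j : Fin d → ℤ, g j ≠ 0 → ω (j i₀ - 1) ≤ ω (j i₀))
    (j : Fin d → ℤ) :
    ω (j i₀) * ‖discreteLap g j - g (j - Pi.single i₀ 1)‖
      ≤ nbrSum (fun n => ω (n i₀) * ‖g n‖) j + 2 * d * (ω (j i₀) * ‖g j‖) := by
  have h1 : discreteLap g j - g (j - Pi.single i₀ 1)
      = ∑ k, (g (j + Pi.single k 1) + (if k = i₀ then 0 else g (j - Pi.single k 1)) - 2 * g j) := by
    have : g (j - Pi.single i₀ 1) = ∑ k, if k = i₀ then g (j - Pi.single k 1) else 0 := by simp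
    rw [this, discreteLap, ← Finset.sum_sub_distrib]
    refine Finset.sum_congr rfl fun k _ => ?_
    split_ifs <;> ring
  have h2 : nbrSum (fun n => ω (n i₀) * ‖g n‖) j + 2 * d * (ω (j i₀) * ‖g j‖)
      = ∑ k, (ω ((j + Pi.single k 1 : Fin d → ℤ) i₀) * ‖g (j + Pi.single k 1)‖
        + ω ((j - Pi.single k 1 : Fin d → ℤ) i₀) * ‖g (j - Pi.single k 1)‖ + 2 * (ω (j i₀) * ‖g j‖)) := by
    rw [Finset.sum_add_distrib, nbrSum]
    simp
    ring
  rw [h1, h2]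
  refine (mul_le_mul_of_nonneg_left (norm_sum_le _ _) (hω _).le).trans ?_
  rw [Finset.mul_sum]
  refine Finset.sum_le_sum fun k _ => ?_
  have h3 : ω (j i₀) * ‖g (j + Pi.single k 1)‖
      ≤ ω ((j + Pi.single k 1 : Fin d → ℤ) i₀) * ‖g (j + Pi.single k 1)‖ := by
    by_cases hg : g (j + Pi.single k 1) = 0
    · simp [hg]
    · refine mul_le_mul_of_nonneg_right ?_ (norm_nonneg _)
      by_cases hk : k = i₀
      · subst hk
        simpa using hmono _ hg
      · simp [Ne.symm hk]
  have h4 : ω (j i₀) * ‖(if k = i₀ then 0 else g (j - Pi.single k 1))‖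
      ≤ ω ((j - Pi.single k 1 : Fin d → ℤ) i₀) * ‖g (j - Pi.single k 1)‖ := by
    split_ifs with hk
    · simpa using mul_nonneg (hω _).le (norm_nonneg _)
    · simp [Ne.symm hk]
  have h5 := mul_le_mul_of_nonneg_left
    ((norm_sub_le (g (j + Pi.single k 1) + (if k = i₀ then 0 else g (j - Pi.single k 1)))
      (2 * g j)).trans (add_le_add_left (norm_add_le _ _) _)) (hω (j i₀)).le
  have h6 : ‖2 * g j‖ = 2 * ‖g j‖ := by simp
  rw [h6] at h5
  refine h5.trans ?_
  rw [mul_add, mul_add]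
  linarith

/-- Conjugating `i∂_t + Δ` by the weight `ω (j i₀) m(t)` turns it into a weighted shift, up to
errors controlled by the equation satisfied by `g` (with `g'` in the role of `∂_t g`). -/
lemma tsum_conjugated_le {d : ℕ} (i₀ : Fin d) (ω : ℤ → ℝ) (hω : ∀ n, 0 < ω n)
    {B : Set (Fin d → ℤ)} (hB : B.Finite) (g g' : (Fin d → ℤ) → ℂ) (hg : ∀ j, j ∉ B → g j = 0)
    (hmono : ∀ j : Fin d → ℤ, g j ≠ 0 → ω (j i₀ - 1) ≤ ω (j i₀))
    {Q : Set (Fin d → ℤ)} (hQ : Q.Finite) (q : (Fin d → ℤ) → ℝ) (hq : ∀ j, j ∉ Q → q j = 0)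
    (hq0 : ∀ j, 0 ≤ q j) {L W m m' : ℝ} (hm : 0 ≤ m)
    (heq : ∀ j, ‖Complex.I * g' j + discreteLap g j‖ ≤ L * ‖g j‖ + nbrSum q j)
    (hW : ∀ j : Fin d → ℤ, nbrSum q j ≠ 0 → ω (j i₀) ≤ W) :
    ∑' j, ‖Complex.I * (ω (j i₀) * (m' * g j + m * g' j))
        + ((ω (j i₀) / ω (j i₀ - 1) : ℝ) : ℂ) *
          (ω ((j - Pi.single i₀ 1 : Fin d → ℤ) i₀) * (m * g (j - Pi.single i₀ 1)))‖ ^ 2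
      ≤ (4 * m' ^ 2 + (4 * (L + 2 * d) ^ 2 + 16 * d ^ 2) * m ^ 2)
          * ∑' j : Fin d → ℤ, ω (j i₀) ^ 2 * ‖g j‖ ^ 2
        + 16 * d ^ 2 * W ^ 2 * m ^ 2 * ∑' j, q j ^ 2 := by
  set F : (Fin d → ℤ) → ℝ := fun j => ω (j i₀) * ‖g j‖ with hF
  have hF0 : ∀ j, 0 ≤ F j := fun j => mul_nonneg (hω _).le (norm_nonneg _)
  have sF : Summable fun j => F j ^ 2 :=
    summable_of_eq_zero_of_finite hB fun j hj => by simp [hF, hg j hj]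
  have sq : Summable fun j => q j ^ 2 :=
    summable_of_eq_zero_of_finite hQ fun j hj => by simp [hq j hj]
  have hpt : ∀ j, ‖Complex.I * (ω (j i₀) * (m' * g j + m * g' j))
        + ((ω (j i₀) / ω (j i₀ - 1) : ℝ) : ℂ) *
          (ω ((j - Pi.single i₀ 1 : Fin d → ℤ) i₀) * (m * g (j - Pi.single i₀ 1)))‖ ^ 2
      ≤ (4 * m' ^ 2 + 4 * (L + 2 * d) ^ 2 * m ^ 2) * F j ^ 2
        + 8 * d * m ^ 2 * nbrSum (fun n => F n ^ 2) j
        + 8 * d * W ^ 2 * m ^ 2 * nbrSum (fun n => q n ^ 2) j := by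
    intro j
    have e1 : Complex.I * (ω (j i₀) * (m' * g j + m * g' j))
        + ((ω (j i₀) / ω (j i₀ - 1) : ℝ) : ℂ) *
          (ω ((j - Pi.single i₀ 1 : Fin d → ℤ) i₀) * (m * g (j - Pi.single i₀ 1)))
        = (ω (j i₀) : ℂ) * ((m' : ℂ) * (Complex.I * g j)
          + m * ((Complex.I * g' j + discreteLap g j)
            - (discreteLap g j - g (j - Pi.single i₀ 1)))) := by
      have h0 : ((ω (j i₀ - 1) : ℝ) : ℂ) ≠ 0 := by exact_mod_cast (hω _).ne'
      simp only [Pi.sub_apply, Pi.single_eq_same, Complex.ofReal_div]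
      field_simp
      ring
    have h1 : ‖(m' : ℂ) * (Complex.I * g j)
          + m * ((Complex.I * g' j + discreteLap g j)
            - (discreteLap g j - g (j - Pi.single i₀ 1)))‖
        ≤ |m'| * ‖g j‖ + m * ((L * ‖g j‖ + nbrSum q j)
          + ‖discreteLap g j - g (j - Pi.single i₀ 1)‖) := by
      refine (norm_add_le _ _).trans ?_
      rw [norm_mul, norm_mul, norm_mul, Complex.norm_I, one_mul, Complex.norm_real,
        Complex.norm_real, Real.norm_eq_abs, Real.norm_of_nonneg hm]
      gcongr
      refine (norm_sub_le _ _).trans ?_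
      gcongr
      exact heq j
    have h2 : ω (j i₀) * nbrSum q j ≤ W * nbrSum q j := by
      by_cases h : nbrSum q j = 0
      · simp [h]
      · exact mul_le_mul_of_nonneg_right (hW j h) (nbrSum_nonneg hq0 j)
    have h3 := weight_mul_norm_discreteLap_sub_le i₀ ω hω g hmono j
    have h4 : ω (j i₀) * (|m'| * ‖g j‖ + m * ((L * ‖g j‖ + nbrSum q j)
          + ‖discreteLap g j - g (j - Pi.single i₀ 1)‖))
        ≤ |m'| * F j + m * ((L + 2 * d) * F j) + m * nbrSum F j + m * (W * nbrSum q j) := by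
      have h5 := mul_le_mul_of_nonneg_left (add_le_add h2 h3) hm
      simp only [hF] at h5 ⊢
      linarith
    have h6 : (|m'| * F j + m * ((L + 2 * d) * F j) + m * nbrSum F j + m * (W * nbrSum q j)) ^ 2
        ≤ 4 * (|m'| * F j) ^ 2 + 4 * (m * ((L + 2 * d) * F j)) ^ 2 + 4 * (m * nbrSum F j) ^ 2
          + 4 * (m * (W * nbrSum q j)) ^ 2 := by
      generalize |m'| * F j = a
      generalize m * ((L + 2 * d) * F j) = b
      generalize m * nbrSum F j = c
      generalize m * (W * nbrSum q j) = e
      nlinarith [sq_nonneg (a - b), sq_nonneg (a - c), sq_nonneg (a - e), sq_nonneg (b - c),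
        sq_nonneg (b - e), sq_nonneg (c - e)]
    have h7 := mul_le_mul_of_nonneg_left (nbrSum_sq_le F j) (by positivity : 0 ≤ 4 * m ^ 2)
    have h8 := mul_le_mul_of_nonneg_left (nbrSum_sq_le q j)
      (by positivity : 0 ≤ 4 * W ^ 2 * m ^ 2)
    rw [e1, norm_mul, Complex.norm_real, Real.norm_of_nonneg (hω _).le]
    refine (pow_le_pow_left₀ (mul_nonneg (hω _).le (norm_nonneg _))
      ((mul_le_mul_of_nonneg_left h1 (hω _).le).trans h4) 2).trans (h6.trans ?_)
    rw [mul_pow, sq_abs]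
    linarith
  have sR := ((sF.mul_left (4 * m' ^ 2 + 4 * (L + 2 * d) ^ 2 * m ^ 2)).add
    ((summable_nbrSum sF).mul_left (8 * d * m ^ 2)))
  have sR' := (summable_nbrSum sq).mul_left (8 * d * W ^ 2 * m ^ 2)
  refine (Summable.tsum_le_tsum hpt
    (Summable.of_nonneg_of_le (fun j => by positivity) hpt (sR.add sR')) (sR.add sR')).trans ?_
  rw [Summable.tsum_add sR sR', Summable.tsum_add (sF.mul_left _)
    ((summable_nbrSum sF).mul_left _), tsum_mul_left, tsum_mul_left, tsum_mul_left,
    tsum_nbrSum sF, tsum_nbrSum sq]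
  have e3 : ∑' j : Fin d → ℤ, ω (j i₀) ^ 2 * ‖g j‖ ^ 2 = ∑' j, F j ^ 2 :=
    tsum_congr fun j => by simp only [hF, mul_pow]
  rw [e3]
  apply le_of_eq
  ring

/-- Restriction of `v` to the ball of radius `R`, extended by zero. -/
noncomputable def truncBall {d : ℕ} (R : ℝ) (v : (Fin d → ℤ) → ℂ) (j : Fin d → ℤ) : ℂ :=
  open Classical in if latNorm j ≤ R then v j else 0

/-- The lattice points of norm at most `R`. -/
noncomputable def latBall (d : ℕ) (R : ℝ) : Finset (Fin d → ℤ) := (finite_latNorm_le R).toFinset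

lemma mem_latBall {d : ℕ} {R : ℝ} {j : Fin d → ℤ} : j ∈ latBall d R ↔ latNorm j ≤ R := by
  simp [latBall]

lemma truncBall_of_le {d : ℕ} {R : ℝ} (v : (Fin d → ℤ) → ℂ) {j : Fin d → ℤ}
    (h : latNorm j ≤ R) : truncBall R v j = v j := if_pos h

lemma truncBall_of_lt {d : ℕ} {R : ℝ} (v : (Fin d → ℤ) → ℂ) {j : Fin d → ℤ}
    (h : R < latNorm j) : truncBall R v j = 0 := if_neg (not_le.2 h)

/-- The modulus of `v` on the shell `R - 2 ≤ |j| ≤ R + 1`, extended by zero. -/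
noncomputable def shellPart {d : ℕ} (R : ℝ) (v : (Fin d → ℤ) → ℂ) (j : Fin d → ℤ) : ℝ :=
  open Classical in if R - 2 ≤ latNorm j ∧ latNorm j ≤ R + 1 then ‖v j‖ else 0

lemma shellPart_nonneg {d : ℕ} (R : ℝ) (v : (Fin d → ℤ) → ℂ) (j : Fin d → ℤ) :
    0 ≤ shellPart R v j := by
  unfold shellPart
  split_ifs <;> positivity

lemma shellPart_eq_zero {d : ℕ} {R : ℝ} (v : (Fin d → ℤ) → ℂ) {j : Fin d → ℤ}
    (h : j ∉ latBall d (R + 1)) : shellPart R v j = 0 :=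
  if_neg fun h' => h (mem_latBall.2 h'.2)

lemma norm_truncBall_le_shellPart {d : ℕ} {R : ℝ} (v : (Fin d → ℤ) → ℂ) {j : Fin d → ℤ}
    (h : R - 2 ≤ latNorm j) : ‖truncBall R v j‖ ≤ shellPart R v j := by
  rcases le_or_gt (latNorm j) R with hj | hj
  · rw [truncBall_of_le v hj, shellPart, if_pos ⟨h, by linarith⟩]
  · rw [truncBall_of_lt v hj, norm_zero]
    exact shellPart_nonneg R v j

lemma norm_sub_truncBall_le_shellPart {d : ℕ} {R : ℝ} (v : (Fin d → ℤ) → ℂ) {j : Fin d → ℤ}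
    (h : latNorm j ≤ R + 1) : ‖v j - truncBall R v j‖ ≤ shellPart R v j := by
  rcases le_or_gt (latNorm j) R with hj | hj
  · rw [truncBall_of_le v hj, sub_self, norm_zero]
    exact shellPart_nonneg R v j
  · rw [truncBall_of_lt v hj, sub_zero, shellPart, if_pos ⟨by linarith, h⟩]

lemma norm_discreteLap_le_of_eq_zero {d : ℕ} (f : (Fin d → ℤ) → ℂ) (q : (Fin d → ℤ) → ℝ)
    (j : Fin d → ℤ) (h0 : f j = 0) (hp : ∀ k, ‖f (j + Pi.single k 1)‖ ≤ q (j + Pi.single k 1))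
    (hm : ∀ k, ‖f (j - Pi.single k 1)‖ ≤ q (j - Pi.single k 1)) :
    ‖discreteLap f j‖ ≤ nbrSum q j := by
  refine (norm_sum_le _ _).trans (Finset.sum_le_sum fun k _ => ?_)
  rw [h0, mul_zero, sub_zero]
  exact (norm_add_le _ _).trans (add_le_add (hp k) (hm k))

lemma discreteLap_sub {d : ℕ} (f g : (Fin d → ℤ) → ℂ) (j : Fin d → ℤ) :
    discreteLap (fun n => f n - g n) j = discreteLap f j - discreteLap g j := by
  unfold discreteLap
  rw [← Finset.sum_sub_distrib]
  exact Finset.sum_congr rfl fun k _ => by ring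

/-- Truncating a solution to a ball produces errors only on the boundary shell. -/
lemma norm_truncBall_equation_le {d : ℕ} {R L : ℝ} (v v' : (Fin d → ℤ) → ℂ)
    (heq : ∀ j, ‖Complex.I * v' j + discreteLap v j‖ ≤ L * ‖v j‖) (j : Fin d → ℤ) :
    ‖Complex.I * truncBall R v' j + discreteLap (truncBall R v) j‖
      ≤ L * ‖truncBall R v j‖ + nbrSum (shellPart R v) j := by
  rcases le_or_gt (latNorm j) R with hj | hj
  · have h1 := norm_discreteLap_le_of_eq_zero (fun n => v n - truncBall R v n) (shellPart R v) j
      (by simp [truncBall_of_le v hj])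
      (fun k => norm_sub_truncBall_le_shellPart v (by linarith [latNorm_add_single_le j k]))
      (fun k => norm_sub_truncBall_le_shellPart v (by linarith [latNorm_sub_single_le j k]))
    rw [discreteLap_sub] at h1
    rw [truncBall_of_le v' hj, truncBall_of_le v hj]
    have h2 : Complex.I * v' j + discreteLap (truncBall R v) j
        = (Complex.I * v' j + discreteLap v j)
          - (discreteLap v j - discreteLap (truncBall R v) j) := by ring
    rw [h2]
    exact (norm_sub_le _ _).trans (add_le_add (heq j) h1)
  · rw [truncBall_of_lt v' hj, truncBall_of_lt v hj, mul_zero, zero_add, norm_zero, mul_zero,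
      zero_add]
    refine norm_discreteLap_le_of_eq_zero _ _ j (truncBall_of_lt v hj) (fun k => ?_) fun k => ?_
    · refine norm_truncBall_le_shellPart v ?_
      have := latNorm_sub_single_le (j + Pi.single k 1) k
      rw [add_sub_cancel_right] at this
      linarith
    · refine norm_truncBall_le_shellPart v ?_
      have := latNorm_add_single_le (j - Pi.single k 1) k
      rw [sub_add_cancel] at this
      linarith

lemma latNorm_le_of_nbrSum_shellPart_ne_zero {d : ℕ} {R : ℝ} (v : (Fin d → ℤ) → ℂ)
    {j : Fin d → ℤ} (h : nbrSum (shellPart R v) j ≠ 0) : latNorm j ≤ R + 2 := by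
  by_contra! hj
  refine h (Finset.sum_eq_zero fun k _ => ?_)
  rw [shellPart_eq_zero, shellPart_eq_zero, add_zero]
  · rw [mem_latBall, not_le]
    have := latNorm_add_single_le (j - Pi.single k 1) k
    rw [sub_add_cancel] at this
    linarith
  · rw [mem_latBall, not_le]
    have := latNorm_sub_single_le (j + Pi.single k 1) k
    rw [add_sub_cancel_right] at this
    linarith

/-- The pairing `Im ⟨p, T r⟩` of weighted truncations, at one lattice point, where `T` is the
weighted backward shift in the direction `i₀`. -/
noncomputable def shiftPairing {d : ℕ} (i₀ : Fin d) (ω : ℤ → ℝ) (p r : (Fin d → ℤ) → ℂ)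
    (j : Fin d → ℤ) : ℂ :=
  p j * star (((ω (j i₀) / ω (j i₀ - 1) : ℝ) : ℂ) * r (j - Pi.single i₀ 1))

/-- Pointwise-in-time Carleman inequality on a ball, with `v'`, `m'` in the role of the time
derivatives of `v`, `m`. -/
lemma carleman_pointwise {d : ℕ} (i₀ : Fin d) (ω : ℤ → ℝ) (hω : ∀ n, 0 < ω n) {R L W μ : ℝ}
    (hmono : ∀ n : ℤ, |(n : ℝ)| ≤ R → ω (n - 1) ≤ ω n)
    (hμ : ∀ n : ℤ, |(n : ℝ)| ≤ R → μ ≤ (ω (n + 1) / ω n) ^ 2 - (ω n / ω (n - 1)) ^ 2)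
    (hW : ∀ n : ℤ, |(n : ℝ)| ≤ R + 2 → ω n ≤ W) (v v' : (Fin d → ℤ) → ℂ)
    (heq : ∀ j, ‖Complex.I * v' j + discreteLap v j‖ ≤ L * ‖v j‖) {m : ℝ} (hm : 0 ≤ m) (m' : ℝ) :
    (μ * m ^ 2 - (4 * m' ^ 2 + (4 * (L + 2 * d) ^ 2 + 16 * d ^ 2) * m ^ 2))
          * ∑ j ∈ latBall d R, ω (j i₀) ^ 2 * ‖v j‖ ^ 2
        - 16 * d ^ 2 * W ^ 2 * m ^ 2 * ∑' j, shellPart R v j ^ 2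
      ≤ 2 * ∑ j ∈ latBall d R,
        (shiftPairing i₀ ω (fun j => ω (j i₀) * (m' * truncBall R v j + m * truncBall R v' j))
            (fun j => ω (j i₀) * (m * truncBall R v j)) j
          + shiftPairing i₀ ω (fun j => ω (j i₀) * (m * truncBall R v j))
            (fun j => ω (j i₀) * (m' * truncBall R v j + m * truncBall R v' j)) j).im := by
  have hz : ∀ (w : (Fin d → ℤ) → ℂ) j, j ∉ latBall d R → truncBall R w j = 0 := fun w j hj =>
    truncBall_of_lt w (by rwa [mem_latBall, not_le] at hj)
  have hB : (↑(latBall d R) : Set (Fin d → ℤ)).Finite := Finset.finite_toSet _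
  have h1 := weighted_shift_commutator hB (Pi.single i₀ 1)
    (fun j => ω (j i₀) / ω (j i₀ - 1)) (fun j => ω (j i₀) * (m * truncBall R v j))
    (fun j => ω (j i₀) * (m' * truncBall R v j + m * truncBall R v' j))
    (fun j hj => by simp [hz v j hj]) (fun j hj => by simp [hz v j hj, hz v' j hj])
  have h2 := tsum_conjugated_le i₀ ω hω hB (truncBall R v) (truncBall R v') (hz v)
    (fun j hj => by
      have hjR : latNorm j ≤ R := by
        by_contra! h
        exact hj (truncBall_of_lt v h)
      exact hmono _ ((abs_coord_le_latNorm j i₀).trans hjR))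
    (Finset.finite_toSet (latBall d (R + 1))) (shellPart R v) (fun j hj => shellPart_eq_zero v hj)
    (shellPart_nonneg R v) (m' := m') hm (norm_truncBall_equation_le v v' heq)
    (fun j hj => hW _ ((abs_coord_le_latNorm j i₀).trans
      (latNorm_le_of_nbrSum_shellPart_ne_zero v hj)))
  have h3 := h1.trans h2
  have h4 : ∑' j : Fin d → ℤ, ω (j i₀) ^ 2 * ‖truncBall R v j‖ ^ 2
      = ∑ j ∈ latBall d R, ω (j i₀) ^ 2 * ‖v j‖ ^ 2 := by
    rw [tsum_eq_sum (s := latBall d R) fun j hj => by simp [hz v j hj]]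
    exact Finset.sum_congr rfl fun j hj => by rw [truncBall_of_le v (mem_latBall.1 hj)]
  rw [h4, tsum_eq_sum (s := latBall d R) fun j hj => by simp [hz v j hj],
    tsum_eq_sum (s := latBall d R) fun j hj => by simp [hz v j hj, hz v' j hj]] at h3
  have h5 : μ * m ^ 2 * ∑ j ∈ latBall d R, ω (j i₀) ^ 2 * ‖v j‖ ^ 2
      ≤ ∑ j ∈ latBall d R, ((ω ((j + Pi.single i₀ 1 : Fin d → ℤ) i₀)
          / ω ((j + Pi.single i₀ 1 : Fin d → ℤ) i₀ - 1)) ^ 2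
        - (ω (j i₀) / ω (j i₀ - 1)) ^ 2) * ‖(ω (j i₀) : ℂ) * (m * truncBall R v j)‖ ^ 2 := by
    rw [Finset.mul_sum]
    refine Finset.sum_le_sum fun j hj => ?_
    have hjR := mem_latBall.1 hj
    have h6 := hμ (j i₀) ((abs_coord_le_latNorm j i₀).trans hjR)
    rw [truncBall_of_le v hjR, norm_mul, norm_mul, Complex.norm_real, Complex.norm_real,
      Real.norm_of_nonneg hm, Real.norm_of_nonneg (hω _).le, Pi.add_apply, Pi.single_eq_same,
      add_sub_cancel_right]
    refine le_trans (le_of_eq ?_) (mul_le_mul_of_nonneg_right h6 (sq_nonneg _))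
    ring
  unfold shiftPairing
  linarith

lemma tsum_shellPart_sq {d : ℕ} (R : ℝ) (v : (Fin d → ℤ) → ℂ) :
    ∑' j, shellPart R v j ^ 2 = ∑ j ∈ latBall d (R + 1), shellPart R v j ^ 2 :=
  tsum_eq_sum fun j hj => by simp [shellPart_eq_zero v hj]

lemma continuousOn_tsum_shellPart_sq {d : ℕ} (R : ℝ) {u : ℝ → (Fin d → ℤ) → ℂ} {I : Set ℝ}
    (hu : ∀ j, ContinuousOn (fun t => u t j) I) :
    ContinuousOn (fun t => ∑' j, shellPart R (u t) j ^ 2) I := by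
  simp_rw [tsum_shellPart_sq]
  refine continuousOn_finsetSum _ fun j _ => ContinuousOn.pow ?_ 2
  unfold shellPart
  split_ifs
  · exact (hu j).norm
  · exact continuousOn_const

lemma hasDerivAt_truncBall {d : ℕ} (R : ℝ) {u : ℝ → (Fin d → ℤ) → ℂ} {v' : (Fin d → ℤ) → ℂ}
    {t : ℝ} (hu : ∀ j, HasDerivAt (fun s => u s j) (v' j) t) (j : Fin d → ℤ) :
    HasDerivAt (fun s => truncBall R (u s) j) (truncBall R v' j) t := by
  unfold truncBall
  split_ifs
  · exact hu j
  · exact hasDerivAt_const _ _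

lemma continuousOn_truncBall {d : ℕ} (R : ℝ) {u : ℝ → (Fin d → ℤ) → ℂ} {I : Set ℝ}
    (hu : ∀ j, ContinuousOn (fun t => u t j) I) (j : Fin d → ℤ) :
    ContinuousOn (fun s => truncBall R (u s) j) I := by
  unfold truncBall
  split_ifs
  · exact hu j
  · exact continuousOn_const

/-- Carleman inequality on a ball: integrated version, for a time weight `m` vanishing at the
endpoints. -/
lemma carleman_integrated {d : ℕ} (i₀ : Fin d) (ω : ℤ → ℝ) (hω : ∀ n, 0 < ω n) {R L W μ : ℝ}
    (hmono : ∀ n : ℤ, |(n : ℝ)| ≤ R → ω (n - 1) ≤ ω n)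
    (hμ : ∀ n : ℤ, |(n : ℝ)| ≤ R → μ ≤ (ω (n + 1) / ω n) ^ 2 - (ω n / ω (n - 1)) ^ 2)
    (hW : ∀ n : ℤ, |(n : ℝ)| ≤ R + 2 → ω n ≤ W) (u u' : ℝ → (Fin d → ℤ) → ℂ)
    (hu : ∀ j, ∀ t ∈ Set.Icc (0 : ℝ) 1,
      HasDerivWithinAt (fun s => u s j) (u' t j) (Set.Icc (0 : ℝ) 1) t)
    (heq : ∀ t ∈ Set.Icc (0 : ℝ) 1, ∀ j,
      ‖Complex.I * u' t j + discreteLap (u t) j‖ ≤ L * ‖u t j‖)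
    (m m' : ℝ → ℝ) (hm : ∀ t ∈ Set.Icc (0 : ℝ) 1, 0 ≤ m t) (hm0 : m 0 = 0) (hm1 : m 1 = 0)
    (hmd : ∀ t, HasDerivAt m (m' t) t) (hm' : Continuous m') :
    ∫ t in (0 : ℝ)..1,
      ((μ * m t ^ 2 - (4 * m' t ^ 2 + (4 * (L + 2 * d) ^ 2 + 16 * d ^ 2) * m t ^ 2))
          * ∑ j ∈ latBall d R, ω (j i₀) ^ 2 * ‖u t j‖ ^ 2
        - 16 * d ^ 2 * W ^ 2 * m t ^ 2 * ∑' j, shellPart R (u t) j ^ 2) ≤ 0 := by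
  have hmc : Continuous m := continuous_iff_continuousAt.2 fun t => (hmd t).continuousAt
  have huc : ∀ j, ContinuousOn (fun t => u t j) (Set.Icc 0 1) := fun j t ht =>
    (hu j t ht).continuousWithinAt
  set p : ℝ → (Fin d → ℤ) → ℂ := fun t j => ω (j i₀) * (m t * truncBall R (u t) j) with hp
  have hpc : ∀ j, ContinuousOn (fun t => p t j) (Set.Icc 0 1) := fun j =>
    continuousOn_const.mul
      ((Complex.continuous_ofReal.comp hmc).continuousOn.mul (continuousOn_truncBall R huc j))
  have hcont : ContinuousOn
      (fun t => 2 * ∑ j ∈ latBall d R, (shiftPairing i₀ ω (p t) (p t) j).im) (Set.Icc 0 1) := by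
    refine continuousOn_const.mul (continuousOn_finsetSum _ fun j _ => ?_)
    exact Complex.continuous_im.comp_continuousOn
      ((hpc j).mul (continuousOn_const.mul (hpc _)).star)
  have hderiv : ∀ t ∈ Set.Ioo (0 : ℝ) 1, HasDerivAt
      (fun t => 2 * ∑ j ∈ latBall d R, (shiftPairing i₀ ω (p t) (p t) j).im)
      (2 * ∑ j ∈ latBall d R, (shiftPairing i₀ ω
          (fun j => ω (j i₀) * (m' t * truncBall R (u t) j + m t * truncBall R (u' t) j)) (p t) j
        + shiftPairing i₀ ω (p t)
          (fun j => ω (j i₀) * (m' t * truncBall R (u t) j + m t * truncBall R (u' t) j)) j).im)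
      t := by
    intro t ht
    have hut : ∀ j, HasDerivAt (fun s => u s j) (u' t j) t := fun j =>
      (hu j t (Set.Ioo_subset_Icc_self ht)).hasDerivAt (Icc_mem_nhds ht.1 ht.2)
    have hpd : ∀ j, HasDerivAt (fun t => p t j)
        (ω (j i₀) * (m' t * truncBall R (u t) j + m t * truncBall R (u' t) j)) t := fun j =>
      ((hmd t).ofReal_comp.mul (hasDerivAt_truncBall R hut j)).const_mul _
    refine (HasDerivAt.fun_sum fun j _ => ?_).const_mul 2
    exact Complex.imCLM.hasFDerivAt.comp_hasDerivAt t
      ((hpd j).mul ((hpd (j - Pi.single i₀ 1)).const_mul _).star)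
  have hle := intervalIntegral.integral_le_sub_of_hasDeriv_right_of_le zero_le_one hcont
    (fun t ht => (hderiv t ht).hasDerivWithinAt) (φ := fun t =>
      (μ * m t ^ 2 - (4 * m' t ^ 2 + (4 * (L + 2 * d) ^ 2 + 16 * d ^ 2) * m t ^ 2))
          * ∑ j ∈ latBall d R, ω (j i₀) ^ 2 * ‖u t j‖ ^ 2
        - 16 * d ^ 2 * W ^ 2 * m t ^ 2 * ∑' j, shellPart R (u t) j ^ 2) ?_ ?_
  · refine hle.trans (le_of_eq ?_)
    simp [hp, hm0, hm1, shiftPairing]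
  · refine ContinuousOn.integrableOn_Icc ?_
    refine ContinuousOn.sub (ContinuousOn.mul ?_ ?_) (ContinuousOn.mul ?_ ?_)
    · exact Continuous.continuousOn (by fun_prop)
    · exact continuousOn_finsetSum _ fun j _ => continuousOn_const.mul ((huc j).norm.pow 2)
    · exact Continuous.continuousOn (by fun_prop)
    · exact continuousOn_tsum_shellPart_sq R huc
  · intro t ht
    have ht' := Set.Ioo_subset_Icc_self ht
    exact carleman_pointwise i₀ ω hω hmono hμ hW (u t) (u' t) (heq t ht') (hm t ht') (m' t)

/-- Lower bound for the mass on the shell in terms of the weight `ω` and the exponent `N` of the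
time cutoff `(t(1-t))^N`. -/
lemma shell_mass_lower_bound {d : ℕ} (i₀ : Fin d) (ω : ℤ → ℝ) (hω : ∀ n, 0 < ω n) {R L W A : ℝ}
    (hR : 0 ≤ R) (N : ℕ) (hN : 1 ≤ N) (hω0 : ω 0 = 1)
    (hmono : ∀ n : ℤ, |(n : ℝ)| ≤ R → ω (n - 1) ≤ ω n)
    (hμ : ∀ n : ℤ, |(n : ℝ)| ≤ R → 4 * (L + 2 * d) ^ 2 + 16 * d ^ 2 + 256 * N ^ 2 + 1
      ≤ (ω (n + 1) / ω n) ^ 2 - (ω n / ω (n - 1)) ^ 2)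
    (hW : ∀ n : ℤ, |(n : ℝ)| ≤ R + 2 → ω n ≤ W) (u u' : ℝ → (Fin d → ℤ) → ℂ)
    (hu : ∀ j, ∀ t ∈ Set.Icc (0 : ℝ) 1,
      HasDerivWithinAt (fun s => u s j) (u' t j) (Set.Icc (0 : ℝ) 1) t)
    (heq : ∀ t ∈ Set.Icc (0 : ℝ) 1, ∀ j,
      ‖Complex.I * u' t j + discreteLap (u t) j‖ ≤ L * ‖u t j‖)
    (hA : ∫ t in (0 : ℝ)..1, ∑ j ∈ latBall d R, ‖u t j‖ ^ 2 ≤ A ^ 2)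
    (h0 : 1 ≤ ∫ t in (1 / 2 - 1 / 8 : ℝ)..(1 / 2 + 1 / 8 : ℝ), ‖u t (0 : Fin d → ℤ)‖ ^ 2) :
    (15 / 64 : ℝ) ^ (2 * N) ≤ 256 * N ^ 2 * (1 / 8) ^ (2 * N) * W ^ 2 * A ^ 2
      + 16 * d ^ 2 * W ^ 2 * ∫ t in (0 : ℝ)..1, ∑' j, shellPart R (u t) j ^ 2 := by
  have huc : ∀ j, ContinuousOn (fun t => u t j) (Set.Icc 0 1) := fun j t ht =>
    (hu j t ht).continuousWithinAt
  set μ : ℝ := 4 * (L + 2 * d) ^ 2 + 16 * d ^ 2 + 256 * N ^ 2 + 1 with hμdef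
  set m : ℝ → ℝ := fun t => (t * (1 - t)) ^ N with hm
  set m' : ℝ → ℝ := fun t => N * (t * (1 - t)) ^ (N - 1) * (1 - 2 * t) with hm'
  set S : ℝ → ℝ := fun t => ∑ j ∈ latBall d R, ω (j i₀) ^ 2 * ‖u t j‖ ^ 2 with hS
  set Q : ℝ → ℝ := fun t => ∑' j, shellPart R (u t) j ^ 2 with hQ
  set D : ℝ → ℝ := fun t =>
    (μ * m t ^ 2 - (4 * m' t ^ 2 + (4 * (L + 2 * d) ^ 2 + 16 * d ^ 2) * m t ^ 2)) * S t
      - 16 * d ^ 2 * W ^ 2 * m t ^ 2 * Q t with hD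
  have hmd : ∀ t, HasDerivAt m (m' t) t := by
    intro t
    have h1 : HasDerivAt (fun t : ℝ => t * (1 - t)) (1 - 2 * t) t := by
      exact ((hasDerivAt_id' t).mul ((hasDerivAt_id' t).const_sub 1)).congr_deriv (by ring)
    exact h1.pow N
  have hm'c : Continuous m' := by fun_prop
  have hmc : Continuous m := by fun_prop
  have hSc : ContinuousOn S (Set.Icc 0 1) :=
    continuousOn_finsetSum _ fun j _ => continuousOn_const.mul ((huc j).norm.pow 2)
  have hQc : ContinuousOn Q (Set.Icc 0 1) := continuousOn_tsum_shellPart_sq R huc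
  have hDc : ContinuousOn D (Set.Icc 0 1) :=
    ((Continuous.continuousOn (by fun_prop)).mul hSc).sub
      ((Continuous.continuousOn (by fun_prop)).mul hQc)
  have hS0 : ∀ t, 0 ≤ S t := fun t => Finset.sum_nonneg fun j _ => by positivity
  have hQ0 : ∀ t, 0 ≤ Q t := fun t => tsum_nonneg fun j => by positivity
  have hint : ∀ {f : ℝ → ℝ}, ContinuousOn f (Set.Icc 0 1) → IntervalIntegrable f volume 0 1 :=
    fun hf => ContinuousOn.intervalIntegrable (by rwa [Set.uIcc_of_le zero_le_one])
  have hDint : ∫ t in (0 : ℝ)..1, D t ≤ 0 :=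
    carleman_integrated i₀ ω hω hmono hμ hW u u' hu heq m m'
      (fun t ht => pow_nonneg (mul_nonneg ht.1 (sub_nonneg.2 ht.2)) N)
      (by simp [hm]; omega) (by simp [hm]; omega) hmd hm'c
  have hSW : ∫ t in (0 : ℝ)..1, S t ≤ W ^ 2 * A ^ 2 := by
    refine le_trans ?_ (mul_le_mul_of_nonneg_left hA (sq_nonneg W))
    rw [← intervalIntegral.integral_const_mul]
    refine intervalIntegral.integral_mono_on zero_le_one (hint hSc) (hint ?_) fun t _ => ?_
    · exact continuousOn_const.mul (continuousOn_finsetSum _ fun j _ => (huc j).norm.pow 2)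
    · rw [Finset.mul_sum]
      refine Finset.sum_le_sum fun j hj => mul_le_mul_of_nonneg_right ?_ (sq_nonneg _)
      refine pow_le_pow_left₀ (hω _).le (hW _ ?_) 2
      linarith [abs_coord_le_latNorm j i₀, mem_latBall.1 hj]
  set P : ℝ → ℝ := fun t => D t + 256 * N ^ 2 * (1 / 8) ^ (2 * N) * S t
    + 16 * d ^ 2 * W ^ 2 * Q t with hP
  have hm_le : ∀ t ∈ Set.Icc (0 : ℝ) 1, m t ^ 2 ≤ 1 := fun t ht =>
    pow_le_one₀ (pow_nonneg (mul_nonneg ht.1 (sub_nonneg.2 ht.2)) N)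
      (pow_le_one₀ (mul_nonneg ht.1 (sub_nonneg.2 ht.2)) (by nlinarith [ht.1, ht.2]))
  have hPlow : ∀ t ∈ Set.Icc (0 : ℝ) 1, (m t ^ 2 + 256 * N ^ 2 * m t ^ 2 - 4 * m' t ^ 2
      + 256 * N ^ 2 * (1 / 8) ^ (2 * N)) * S t ≤ P t := by
    intro t ht
    have h1 : 0 ≤ 16 * d ^ 2 * W ^ 2 * (1 - m t ^ 2) * Q t :=
      mul_nonneg (mul_nonneg (by positivity) (sub_nonneg.2 (hm_le t ht))) (hQ0 t)
    simp only [hP, hD, hμdef]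
    linarith
  have hm'sq : ∀ t ∈ Set.Icc (0 : ℝ) 1, m' t ^ 2 ≤ N ^ 2 * (t * (1 - t)) ^ (2 * (N - 1)) := by
    intro t ht
    have h1 : (1 - 2 * t) ^ 2 ≤ 1 := by nlinarith [ht.1, ht.2]
    have h2 : 0 ≤ N ^ 2 * (t * (1 - t)) ^ (2 * (N - 1)) :=
      mul_nonneg (by positivity) (by rw [pow_mul]; positivity)
    have h3 := mul_le_mul_of_nonneg_left h1 h2
    simp only [hm']
    rw [mul_pow, mul_pow, ← pow_mul, mul_comm (N - 1) 2]
    linarith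
  have hpow : ∀ s : ℝ, s ^ (2 * N) = s ^ 2 * s ^ (2 * (N - 1)) := fun s => by
    rw [← pow_add]
    congr 1
    omega
  have hmsq : ∀ t, m t ^ 2 = (t * (1 - t)) ^ 2 * (t * (1 - t)) ^ (2 * (N - 1)) := fun t => by
    rw [← hpow, mul_comm 2 N, pow_mul]
  have hlarge : ∀ t ∈ Set.Icc (0 : ℝ) 1, 1 / 8 ≤ t * (1 - t) →
      4 * m' t ^ 2 ≤ 256 * N ^ 2 * m t ^ 2 := by
    intro t ht hs
    have h1 := hm'sq t ht
    have h2 : (1 / 8 : ℝ) ^ 2 ≤ (t * (1 - t)) ^ 2 := pow_le_pow_left₀ (by norm_num) hs 2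
    have h3 : 0 ≤ N ^ 2 * (t * (1 - t)) ^ (2 * (N - 1)) :=
      mul_nonneg (by positivity) (by rw [pow_mul]; positivity)
    have h4 := mul_le_mul_of_nonneg_right h2 h3
    rw [hmsq]
    linarith
  have hP0 : ∀ t ∈ Set.Icc (0 : ℝ) 1, 0 ≤ P t := by
    intro t ht
    refine le_trans (mul_nonneg ?_ (hS0 t)) (hPlow t ht)
    have hb : (0 : ℝ) ≤ 256 * N ^ 2 * (1 / 8) ^ (2 * N) := by positivity
    have hc : 0 ≤ 256 * N ^ 2 * m t ^ 2 := by positivity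
    rcases le_or_gt (1 / 8) (t * (1 - t)) with hs | hs
    · linarith [hlarge t ht hs, sq_nonneg (m t)]
    · have h1 := hm'sq t ht
      have h2 : (t * (1 - t)) ^ (2 * (N - 1)) ≤ (1 / 8) ^ (2 * (N - 1)) :=
        pow_le_pow_left₀ (mul_nonneg ht.1 (sub_nonneg.2 ht.2)) hs.le _
      have h3 := mul_le_mul_of_nonneg_left h2 (sq_nonneg (N : ℝ))
      rw [hpow]
      linarith [sq_nonneg (m t)]
  have hPmid : ∀ t ∈ Set.Icc (1 / 2 - 1 / 8 : ℝ) (1 / 2 + 1 / 8),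
      (15 / 64 : ℝ) ^ (2 * N) * ‖u t 0‖ ^ 2 ≤ P t := by
    intro t ht
    have ht' : t ∈ Set.Icc (0 : ℝ) 1 := ⟨by linarith [ht.1], by linarith [ht.2]⟩
    have hs : 15 / 64 ≤ t * (1 - t) := by nlinarith [ht.1, ht.2]
    have h1 : (15 / 64 : ℝ) ^ (2 * N) ≤ m t ^ 2 := by
      rw [hmsq, ← hpow]
      exact pow_le_pow_left₀ (by norm_num) hs _
    have h2 : ‖u t 0‖ ^ 2 ≤ S t := by
      have h3 := Finset.single_le_sum (s := latBall d R)
        (f := fun j => ω (j i₀) ^ 2 * ‖u t j‖ ^ 2) (fun j _ => by positivity)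
        (mem_latBall.2 (by rw [latNorm_zero]; exact hR) : (0 : Fin d → ℤ) ∈ latBall d R)
      simpa [hω0] using h3
    refine le_trans (mul_le_mul ?_ h2 (sq_nonneg _) ?_) (hPlow t ht')
    · have := hlarge t ht' (by linarith)
      have hb : (0 : ℝ) ≤ 256 * N ^ 2 * (1 / 8) ^ (2 * N) := by positivity
      linarith
    · have := hlarge t ht' (by linarith)
      have hb : (0 : ℝ) ≤ 256 * N ^ 2 * (1 / 8) ^ (2 * N) := by positivity
      linarith [sq_nonneg (m t)]
  have hPc : ContinuousOn P (Set.Icc 0 1) :=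
    (hDc.add (continuousOn_const.mul hSc)).add (continuousOn_const.mul hQc)
  have hsub : Set.Icc (1 / 2 - 1 / 8 : ℝ) (1 / 2 + 1 / 8) ⊆ Set.Icc 0 1 :=
    Set.Icc_subset_Icc (by norm_num) (by norm_num)
  have hmidint : ∀ {f : ℝ → ℝ}, ContinuousOn f (Set.Icc 0 1) →
      IntervalIntegrable f volume (1 / 2 - 1 / 8) (1 / 2 + 1 / 8) := fun hf =>
    ContinuousOn.intervalIntegrable (by
      rw [Set.uIcc_of_le (by norm_num)]
      exact hf.mono hsub)
  have h1 : (15 / 64 : ℝ) ^ (2 * N) ≤ ∫ t in (1 / 2 - 1 / 8 : ℝ)..(1 / 2 + 1 / 8), P t := by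
    have h2 := mul_le_mul_of_nonneg_left h0 (by positivity : (0 : ℝ) ≤ (15 / 64) ^ (2 * N))
    rw [mul_one, ← intervalIntegral.integral_const_mul] at h2
    exact h2.trans (intervalIntegral.integral_mono_on (by norm_num)
      (hmidint (continuousOn_const.mul ((huc 0).norm.pow 2))) (hmidint hPc) hPmid)
  have h2 : ∫ t in (1 / 2 - 1 / 8 : ℝ)..(1 / 2 + 1 / 8), P t ≤ ∫ t in (0 : ℝ)..1, P t :=
    intervalIntegral.integral_mono_interval (by norm_num) (by norm_num) (by norm_num)
      (ae_restrict_of_forall_mem measurableSet_Ioc fun t ht => hP0 t ⟨ht.1.le, ht.2⟩) (hint hPc)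
  have h3 : ∫ t in (0 : ℝ)..1, P t = (∫ t in (0 : ℝ)..1, D t)
      + 256 * N ^ 2 * (1 / 8) ^ (2 * N) * (∫ t in (0 : ℝ)..1, S t)
      + 16 * d ^ 2 * W ^ 2 * ∫ t in (0 : ℝ)..1, Q t := by
    simp only [hP]
    rw [intervalIntegral.integral_add ((hint hDc).add ((hint hSc).const_mul _))
        ((hint hQc).const_mul _), intervalIntegral.integral_add (hint hDc)
        ((hint hSc).const_mul _), intervalIntegral.integral_const_mul,
      intervalIntegral.integral_const_mul]
  have h4 := mul_le_mul_of_nonneg_left hSW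
    (by positivity : (0 : ℝ) ≤ 256 * N ^ 2 * (1 / 8) ^ (2 * N))
  linarith

/-- The spatial Carleman weight: linear exponential growth with a slightly convex correction. -/
noncomputable def carlemanWeight (R : ℝ) (n : ℤ) : ℝ :=
  Real.exp (n ^ 2 / R + (3 + 3 * Real.log R) * n)

lemma carlemanWeight_mono {R : ℝ} (hR : 1 ≤ R) {n : ℤ} (hn : |(n : ℝ)| ≤ R) :
    carlemanWeight R (n - 1) ≤ carlemanWeight R n := by
  refine Real.exp_le_exp.2 ?_
  have hR0 : 0 < R := by linarith
  have h1 : (1 - 2 * (n : ℝ)) / R ≤ 3 := by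
    rw [div_le_iff₀ hR0]
    linarith [(abs_le.1 hn).1]
  have h2 := Real.log_nonneg hR
  have h3 : ((n - 1 : ℤ) : ℝ) ^ 2 / R = (n : ℝ) ^ 2 / R + (1 - 2 * (n : ℝ)) / R := by
    push_cast
    ring
  rw [h3]
  push_cast
  linarith

lemma le_carlemanWeight_ratio {R : ℝ} (hR : 1 ≤ R) {n : ℤ} (hn : |(n : ℝ)| ≤ R) :
    4 * R ^ 5 ≤ (carlemanWeight R (n + 1) / carlemanWeight R n) ^ 2
      - (carlemanWeight R n / carlemanWeight R (n - 1)) ^ 2 := by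
  have hR0 : 0 < R := by linarith
  set x : ℝ := 2 * ((2 * n - 1) / R + (3 + 3 * Real.log R)) with hx
  have h1 : (carlemanWeight R n / carlemanWeight R (n - 1)) ^ 2 = Real.exp x := by
    rw [carlemanWeight, carlemanWeight, ← Real.exp_sub, ← Real.exp_nat_mul, hx]
    congr 1
    push_cast
    ring
  have h2 : (carlemanWeight R (n + 1) / carlemanWeight R n) ^ 2
      = Real.exp x * Real.exp (4 / R) := by
    rw [carlemanWeight, carlemanWeight, ← Real.exp_sub, ← Real.exp_nat_mul, hx, ← Real.exp_add]
    congr 1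
    push_cast
    ring
  have h3 : R ^ 6 ≤ Real.exp x := by
    have h4 : R ^ 6 = Real.exp (6 * Real.log R) := by
      rw [← Real.exp_log hR0, ← Real.exp_nat_mul, Real.log_exp]
      norm_num
    rw [h4]
    refine Real.exp_le_exp.2 ?_
    have h5 : -3 ≤ (2 * (n : ℝ) - 1) / R := by
      rw [le_div_iff₀ hR0]
      linarith [(abs_le.1 hn).1]
    linarith
  have h6 : 4 / R ≤ Real.exp (4 / R) - 1 := by linarith [Real.add_one_le_exp (4 / R)]
  have h7 := mul_le_mul h3 h6 (by positivity) (Real.exp_pos _).le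
  have h8 : R ^ 6 * (4 / R) = 4 * R ^ 5 := by
    field_simp
  rw [h1, h2]
  linarith

lemma carlemanWeight_le {R : ℝ} (hR : 2 ≤ R) (hlog : 1 ≤ Real.log R) {n : ℤ}
    (hn : |(n : ℝ)| ≤ R + 2) : carlemanWeight R n ≤ Real.exp (16 * (R * Real.log R)) := by
  refine Real.exp_le_exp.2 ?_
  have hR0 : 0 < R := by linarith
  have hn2 : |(n : ℝ)| ≤ 2 * R := by linarith
  have h1 : (n : ℝ) ^ 2 / R ≤ 4 * R := by
    rw [div_le_iff₀ hR0, ← sq_abs]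
    nlinarith [abs_nonneg (n : ℝ)]
  have h2 : (3 + 3 * Real.log R) * n ≤ (3 + 3 * Real.log R) * (2 * R) :=
    mul_le_mul_of_nonneg_left ((le_abs_self _).trans hn2) (by linarith)
  have h3 : R ≤ R * Real.log R := le_mul_of_one_le_right hR0.le hlog
  linarith

lemma integral_ball_mass_le {d : ℕ} (R A : ℝ) (u : ℝ → (Fin d → ℤ) → ℂ)
    (hu : ∀ j, ContinuousOn (fun t => u t j) (Set.Icc 0 1))
    (hA : (∫⁻ t in Set.Icc (0 : ℝ) 1, ∑' j : Fin d → ℤ, ((‖u t j‖₊ : ℝ≥0∞)) ^ 2) ≤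
      ENNReal.ofReal (A ^ 2)) :
    ∫ t in (0 : ℝ)..1, ∑ j ∈ latBall d R, ‖u t j‖ ^ 2 ≤ A ^ 2 := by
  have hc : ContinuousOn (fun t => ∑ j ∈ latBall d R, ‖u t j‖ ^ 2) (Set.Icc 0 1) :=
    continuousOn_finsetSum _ fun j _ => (hu j).norm.pow 2
  rw [intervalIntegral.integral_of_le zero_le_one,
    ← ENNReal.ofReal_le_ofReal_iff (sq_nonneg A), ofReal_integral_eq_lintegral_ofReal
      (hc.integrableOn_Icc.mono_set Set.Ioc_subset_Icc_self)
      (Filter.Eventually.of_forall fun t => Finset.sum_nonneg fun j _ => by positivity)]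
  refine ((lintegral_mono_set Set.Ioc_subset_Icc_self).trans (lintegral_mono fun t => ?_)).trans hA
  rw [ENNReal.ofReal_sum_of_nonneg fun j _ => by positivity]
  refine le_trans (le_of_eq (Finset.sum_congr rfl fun j _ => ?_)) (ENNReal.sum_le_tsum _)
  rw [ENNReal.ofReal_pow (norm_nonneg _), ofReal_norm]
  rfl

/-- Choice of the exponent `N ≈ 64 R log R`, turning the weighted bound into an exponential one. -/
lemma exp_le_of_weighted_bound {A D R Λ : ℝ} {N : ℕ} (hR : 2200000 ≤ R)
    (hRA : 2200000 * A ^ 2 ≤ R) (hD : 0 < D) (hRD : 1000 * D ≤ R) (hlog : 1 ≤ Real.log R)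
    (hN1 : 64 * (R * Real.log R) ≤ N) (hN2 : N ≤ 65 * (R * Real.log R))
    (h : (15 / 64 : ℝ) ^ (2 * N)
      ≤ 256 * N ^ 2 * (1 / 8) ^ (2 * N) * Real.exp (16 * (R * Real.log R)) ^ 2 * A ^ 2
        + 16 * D ^ 2 * Real.exp (16 * (R * Real.log R)) ^ 2 * Λ) :
    120 ^ 2 * Real.exp (-240 * (R * Real.log R)) ≤ Λ := by
  have hR0 : 0 < R := by linarith
  have hRρ : R ≤ R * Real.log R := le_mul_of_one_le_right hR0.le hlog
  have hρR : R * Real.log R ≤ R * R :=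
    mul_le_mul_of_nonneg_left ((Real.log_le_sub_one_of_pos hR0).trans (by linarith)) hR0.le
  have hlogρ : Real.log R ≤ R * Real.log R := by nlinarith
  set ρ := R * Real.log R with hρ
  have hpow : ∀ k : ℕ, R ^ k = Real.exp (k * Real.log R) := fun k => by
    rw [Real.exp_nat_mul, Real.exp_log hR0]
  have hNsq : (N : ℝ) ^ 2 ≤ 4225 * R ^ 4 := by
    have h1 : (N : ℝ) ≤ 65 * (R * R) := by linarith
    have h2 := pow_le_pow_left₀ (Nat.cast_nonneg N) h1 2
    linarith
  have hW : Real.exp (16 * ρ) ^ 2 = Real.exp (32 * ρ) := by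
    rw [← Real.exp_nat_mul]
    congr 1
    push_cast
    ring
  rw [hW] at h
  have h1 : 512 * N ^ 2 * A ^ 2 ≤ Real.exp (32 * ρ) := by
    have h2 : 512 * N ^ 2 * A ^ 2 ≤ R ^ 5 := by
      have h3 := mul_le_mul_of_nonneg_right hNsq (sq_nonneg A)
      have h4 := mul_le_mul_of_nonneg_left hRA (by positivity : 0 ≤ R ^ 4)
      have h5 : 0 ≤ R ^ 4 * A ^ 2 := by positivity
      linarith
    refine h2.trans ?_
    rw [hpow]
    refine Real.exp_le_exp.2 ?_
    push_cast
    linarith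
  have h2 : Real.exp (64 * ρ) ≤ (15 / 8 : ℝ) ^ (2 * N) := by
    have h3 : Real.exp 1 ≤ (15 / 8 : ℝ) ^ 2 := by linarith [Real.exp_one_lt_d9]
    rw [pow_mul]
    refine le_trans ?_ (pow_le_pow_left₀ (Real.exp_pos _).le h3 N)
    rw [← Real.exp_nat_mul]
    exact Real.exp_le_exp.2 (by linarith)
  have h3 : 256 * N ^ 2 * (1 / 8) ^ (2 * N) * Real.exp (32 * ρ) * A ^ 2
      ≤ (15 / 64 : ℝ) ^ (2 * N) / 2 := by
    have h4 : (15 / 64 : ℝ) ^ (2 * N) = (15 / 8) ^ (2 * N) * (1 / 8) ^ (2 * N) := by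
      rw [← mul_pow]
      norm_num
    have h5 : 512 * N ^ 2 * A ^ 2 * Real.exp (32 * ρ) ≤ Real.exp (64 * ρ) := by
      refine (mul_le_mul_of_nonneg_right h1 (Real.exp_pos _).le).trans (le_of_eq ?_)
      rw [← Real.exp_add]
      congr 1
      ring
    have h6 := mul_le_mul_of_nonneg_right (h5.trans h2)
      (by positivity : (0 : ℝ) ≤ (1 / 8) ^ (2 * N))
    rw [h4]
    linarith
  have h4 : Real.exp (-195 * ρ) ≤ (15 / 64 : ℝ) ^ (2 * N) := by
    have h5 : Real.exp (-3) ≤ (15 / 64 : ℝ) ^ 2 := by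
      have h6 : (2.7 : ℝ) ^ 3 ≤ Real.exp 1 ^ 3 :=
        pow_le_pow_left₀ (by norm_num) (by linarith [Real.exp_one_gt_d9]) 3
      rw [← Real.exp_nat_mul] at h6
      norm_num at h6
      rw [Real.exp_neg]
      refine inv_le_of_inv_le₀ (by norm_num) ?_
      norm_num
      linarith
    rw [pow_mul]
    refine le_trans ?_ (pow_le_pow_left₀ (Real.exp_pos _).le h5 N)
    rw [← Real.exp_nat_mul]
    exact Real.exp_le_exp.2 (by linarith)
  have h5 : 120 ^ 2 * 32 * D ^ 2 ≤ Real.exp (13 * ρ) := by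
    have h6 : 120 ^ 2 * 32 * D ^ 2 ≤ R ^ 2 := by nlinarith
    refine h6.trans ?_
    rw [hpow]
    refine Real.exp_le_exp.2 ?_
    push_cast
    linarith
  have h6 : 120 ^ 2 * Real.exp (-240 * ρ) * (32 * D ^ 2 * Real.exp (32 * ρ))
      ≤ Λ * (32 * D ^ 2 * Real.exp (32 * ρ)) := by
    have h7 := mul_le_mul_of_nonneg_right h5 (Real.exp_pos (-208 * ρ)).le
    rw [← Real.exp_add] at h7
    have h8 : Real.exp (-240 * ρ) * Real.exp (32 * ρ) = Real.exp (-208 * ρ) := by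
      rw [← Real.exp_add]
      congr 1
      ring
    have h9 : 13 * ρ + -208 * ρ = -195 * ρ := by ring
    rw [h9] at h7
    calc 120 ^ 2 * Real.exp (-240 * ρ) * (32 * D ^ 2 * Real.exp (32 * ρ))
        = 120 ^ 2 * 32 * D ^ 2 * (Real.exp (-240 * ρ) * Real.exp (32 * ρ)) := by ring
      _ ≤ _ := by rw [h8]; linarith
  exact le_of_mul_le_mul_right h6 (by positivity)

/-- **Lower bound for solutions to the discrete Schrödinger equation.**
If `u ∈ C¹([0,1], ℓ²(ℤ^d))` satisfies `|i∂_t u_j + Δ_d u_j| ≤ |V_j u_j|`, with total mass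
`∫₀¹ Σ_j |u_j(t)|² dt ≤ A²`, `∫_{1/2-1/8}^{1/2+1/8} |u_0(t)|² dt ≥ 1` and `‖V‖_∞ ≤ L`,
then there are `R₀ = R₀(d,A,L) > 0` and `c = c(d) > 0` such that for all `R ≥ R₀`,
`λ(R) = (∫₀¹ Σ_{R-2 ≤ |j| ≤ R+1} |u_j(t)|² dt)^{1/2} ≥ c e^{-cR log R}`. -/
theorem lower_bound_discrete_schrodinger (d : ℕ) (hd : 1 ≤ d) :
    ∃ c : ℝ, 0 < c ∧
      ∀ A L : ℝ, ∃ R₀ : ℝ, 0 < R₀ ∧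
        ∀ u u' V : ℝ → (Fin d → ℤ) → ℂ,
          -- `u ∈ C¹([0,1], ℓ²(ℤ^d))`, with time derivative `u'`
          (∀ j, ∀ t ∈ Set.Icc (0 : ℝ) 1,
            HasDerivWithinAt (fun s => u s j) (u' t j) (Set.Icc (0 : ℝ) 1) t) →
          (∀ j, ContinuousOn (fun t => u' t j) (Set.Icc (0 : ℝ) 1)) →
          (∀ t ∈ Set.Icc (0 : ℝ) 1, Summable fun j => ‖u t j‖ ^ 2) →
          -- the differential inequality `|i ∂_t u_j + Δ_d u_j| ≤ |V_j u_j|`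
          (∀ t ∈ Set.Icc (0 : ℝ) 1, ∀ j,
            ‖Complex.I * u' t j + discreteLap (u t) j‖ ≤ ‖V t j * u t j‖) →
          -- `∫₀¹ Σ_j |u_j(t)|² dt ≤ A²`
          (∫⁻ t in Set.Icc (0 : ℝ) 1, ∑' j : Fin d → ℤ, ((‖u t j‖₊ : ℝ≥0∞)) ^ 2) ≤
            ENNReal.ofReal (A ^ 2) →
          -- `∫_{1/2-1/8}^{1/2+1/8} |u_0(t)|² dt ≥ 1`
          (1 ≤ ∫ t in (1 / 2 - 1 / 8 : ℝ)..(1 / 2 + 1 / 8 : ℝ), ‖u t (0 : Fin d → ℤ)‖ ^ 2) →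
          -- `‖V‖_∞ ≤ L`
          (∀ t ∈ Set.Icc (0 : ℝ) 1, ∀ j, ‖V t j‖ ≤ L) →
          ∀ R : ℝ, R₀ ≤ R →
            c * Real.exp (-c * R * Real.log R) ≤
              Real.sqrt (∫ t in (0 : ℝ)..1, ∑' j : Fin d → ℤ,
                if R - 2 ≤ latNorm j ∧ latNorm j ≤ R + 1 then ‖u t j‖ ^ 2 else 0) := by
  refine ⟨120, by norm_num, fun A L => ⟨2200000 + 2200000 * A ^ 2 + 1000 * d
    + (4 * (L + 2 * d) ^ 2 + 16 * d ^ 2 + 1), by positivity, ?_⟩⟩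
  intro u u' V hu _ _ heq hA h0 hV R hR
  have hA0 := sq_nonneg A
  have hL0 : 0 ≤ (L + 2 * d) ^ 2 := sq_nonneg _
  have hd0 : (1 : ℝ) ≤ d := by exact_mod_cast hd
  have hd2 : (0 : ℝ) ≤ (d : ℝ) ^ 2 := sq_nonneg _
  have hR1 : 2200000 ≤ R := by linarith
  have hR0 : 0 < R := by linarith
  have hlog : 1 ≤ Real.log R := by
    rw [Real.le_log_iff_exp_le hR0]
    linarith [Real.exp_one_lt_d9]
  have hρ1 : 1 ≤ R * Real.log R := by nlinarith
  have hρR : R * Real.log R ≤ R * R :=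
    mul_le_mul_of_nonneg_left ((Real.log_le_sub_one_of_pos hR0).trans (by linarith)) hR0.le
  set N : ℕ := ⌈64 * (R * Real.log R)⌉₊ with hN
  have hN1 : 64 * (R * Real.log R) ≤ N := Nat.le_ceil _
  have hN2 : (N : ℝ) ≤ 65 * (R * Real.log R) := by
    linarith [Nat.ceil_lt_add_one (by linarith : 0 ≤ 64 * (R * Real.log R))]
  have hN0 : 1 ≤ N := by
    have : (1 : ℝ) ≤ N := by linarith
    exact_mod_cast this
  have hNsq : (N : ℝ) ^ 2 ≤ 4225 * R ^ 4 := by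
    have h1 : (N : ℝ) ≤ 65 * (R * R) := by linarith
    have h2 := pow_le_pow_left₀ (Nat.cast_nonneg N) h1 2
    linarith
  have hμ : 4 * (L + 2 * d) ^ 2 + 16 * d ^ 2 + 256 * N ^ 2 + 1 ≤ 4 * R ^ 5 := by
    have h1 := mul_le_mul_of_nonneg_right hR1 (by positivity : 0 ≤ R ^ 4)
    have h2 : R ≤ R ^ 5 := le_self_pow₀ (by linarith) (by norm_num)
    linarith
  have huc : ∀ j, ContinuousOn (fun t => u t j) (Set.Icc 0 1) := fun j t ht =>
    (hu j t ht).continuousWithinAt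
  have hmain := shell_mass_lower_bound (⟨0, hd⟩ : Fin d) (carlemanWeight R)
    (fun n => Real.exp_pos _) hR0.le N hN0 (by simp [carlemanWeight])
    (fun n hn => carlemanWeight_mono (by linarith) hn)
    (fun n hn => hμ.trans (le_carlemanWeight_ratio (by linarith) hn))
    (fun n hn => carlemanWeight_le (by linarith) hlog hn) u u' hu
    (fun t ht j => (heq t ht j).trans (by
      rw [norm_mul]
      exact mul_le_mul_of_nonneg_right (hV t ht j) (norm_nonneg _)))
    (integral_ball_mass_le R A u huc hA) h0
  have hfin := exp_le_of_weighted_bound hR1 (by linarith) (by linarith) (by linarith) hlog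
    hN1 hN2 hmain
  have hshell : ∀ t, (∑' j : Fin d → ℤ,
      if R - 2 ≤ latNorm j ∧ latNorm j ≤ R + 1 then ‖u t j‖ ^ 2 else 0)
      = ∑' j, shellPart R (u t) j ^ 2 := fun t => tsum_congr fun j => by
    unfold shellPart
    split_ifs <;> simp
  simp_rw [hshell]
  refine Real.le_sqrt_of_sq_le (le_trans (le_of_eq ?_) hfin)
  rw [mul_pow, ← Real.exp_nat_mul]
  congr 2
  push_cast
  ring
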